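/- Let A_1, A_2 ⊂ ℤ² be full-dimensional finite configurations, and for j ≠ i let ℰ′_j denote the set of edges of A_j that are not strongly parallel to any edge of A_i. Then the sum of the mixed multiplicities over the vertices of A_i is bounded below by the total normalized length of the edges in ℰ′_j: Σ_{v ∈ Vert(A_i)} mmult(v) ≥ Σ_{e ∈ ℰ′_j} ℓ(e). -/

import Mathlib

open scoped Pointwise
open MeasureTheory

noncomputable section

abbrev Pt : Type := ℤ × ℤ

def toR2 (p : Pt) : ℝ × ℝ := ((p.1 : ℝ), (p.2 : ℝ))

/-- Normalized lattice area (a primitive lattice triangle has area 1). -/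
def narea (A : Finset Pt) : ℝ :=
  2 * (volume (convexHull ℝ (toR2 '' (A : Set Pt)))).toReal

/-- A planar configuration is full-dimensional if its points are not collinear. -/
def FullDim (A : Finset Pt) : Prop := ¬ Collinear ℝ (toR2 '' (A : Set Pt))

/-- Mixed volume (mixed area) of the convex hulls of two configurations. -/
def mvol (A B : Finset Pt) : ℝ := (narea (A + B) - narea A - narea B) / 2

def IsVertex (A : Finset Pt) (v : Pt) : Prop :=
  v ∈ A ∧ toR2 v ∉ convexHull ℝ (toR2 '' ((A.erase v) : Set Pt))

/-- Mixed multiplicity of a point of the first configuration. -/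
def mmult (A B : Finset Pt) (v : Pt) : ℝ := mvol A B - mvol (A.erase v) B

def dotZ (w p : Pt) : ℤ := w.1 * p.1 + w.2 * p.2

/-- `e` is the edge of `A` with primitive inner normal `w`, supported at level `c`. -/
def IsEdgeWith (A : Finset Pt) (w : Pt) (c : ℤ) (e : Finset Pt) : Prop :=
  Int.gcd w.1 w.2 = 1 ∧ (∀ a ∈ A, c ≤ dotZ w a) ∧
    e = A.filter (fun a => dotZ w a = c) ∧ 2 ≤ e.card

def IsEdge (A e : Finset Pt) : Prop := ∃ w c, IsEdgeWith A w c e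

def MinOnIs (s : Finset Pt) (g : Pt → ℤ) (m : ℤ) : Prop :=
  (∃ a ∈ s, g a = m) ∧ ∀ a ∈ s, m ≤ g a

/-- Subdiagram volume `u(e,A)` of an edge `e` of a planar configuration `A`. -/
def uEdge (A e : Finset Pt) : ℕ :=
  sSup {u : ℕ | ∃ w c, IsEdgeWith A w c e ∧ MinOnIs (A \ e) (dotZ w) (c + u)}

/-- Normalized lattice length of a segment: number of lattice points minus one. -/
def llen (e : Finset Pt) : ℕ :=
  {z : Pt | toR2 z ∈ convexHull ℝ (toR2 '' (e : Set Pt))}.ncard - 1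

/-- Edges `e` of `A` and `f` of `B` are strongly parallel: parallel with the same
inner normal direction. -/
def StronglyParallel (A B e f : Finset Pt) : Prop :=
  ∃ w c c', IsEdgeWith A w c e ∧ IsEdgeWith B w c' f

section Disc

variable (K : Type) [Field K]

/-- value of the Laurent monomial `x^a` at a point of the torus. -/
def mon2 (u : Kˣ × Kˣ) (a : Pt) : K := ((u.1 ^ a.1 * u.2 ^ a.2 : Kˣ) : K)

/-- value of a Laurent polynomial with support `B` and coefficients `h`. -/
def lval (B : Finset Pt) (h : Pt → K) (u : Kˣ × Kˣ) : K :=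
  ∑ a ∈ B, h a * mon2 K u a

/-- `u` is an isolated point of `S` in the Zariski topology of the torus. -/
def IsolatedIn (S : Set (Kˣ × Kˣ)) (u : Kˣ × Kˣ) : Prop :=
  ∃ (B : Finset Pt) (h : Pt → K), lval K B h u ≠ 0 ∧ ∀ v ∈ S, lval K B h v ≠ 0 → v = u

/-- value of the Laurent polynomial with support `A` and coefficient vector `c`. -/
def feval (A : Finset Pt) (c : {a // a ∈ A} → K) (u : Kˣ × Kˣ) : K :=
  ∑ a ∈ A.attach, c a * mon2 K u a.1

/-- the gradient `(∂f/∂x₁, ∂f/∂x₂)` at a point of the torus. -/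
def fgrad (A : Finset Pt) (c : {a // a ∈ A} → K) (u : Kˣ × Kˣ) : K × K :=
  (∑ a ∈ A.attach, c a * (a.1.1 : K) * mon2 K u (a.1.1 - 1, a.1.2),
   ∑ a ∈ A.attach, c a * (a.1.2 : K) * mon2 K u (a.1.1, a.1.2 - 1))

/-- the space of coefficient vectors of a pair of configurations. -/
abbrev Coef (A₁ A₂ : Finset Pt) : Type := ({a // a ∈ A₁} → K) × ({a // a ∈ A₂} → K)

/-- common solutions in the torus of the system `f₁ = f₂ = 0`. -/
def sols (A₁ A₂ : Finset Pt) (c : Coef K A₁ A₂) : Set (Kˣ × Kˣ) :=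
  {u | feval K A₁ c.1 u = 0 ∧ feval K A₂ c.2 u = 0}

/-- the system given by `c` has a non-degenerate multiple root: an isolated common
solution in the torus at which the two gradients are linearly dependent but
each of them is nonzero. -/
def HasNDMR (A₁ A₂ : Finset Pt) (c : Coef K A₁ A₂) : Prop :=
  ∃ u ∈ sols K A₁ A₂ c, IsolatedIn K (sols K A₁ A₂ c) u ∧
    fgrad K A₁ c.1 u ≠ 0 ∧ fgrad K A₂ c.2 u ≠ 0 ∧
    (fgrad K A₁ c.1 u).1 * (fgrad K A₂ c.2 u).2
      = (fgrad K A₁ c.1 u).2 * (fgrad K A₂ c.2 u).1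

/-- the mixed discriminantal locus. -/
def discLocus (A₁ A₂ : Finset Pt) : Set (Coef K A₁ A₂) := {c | HasNDMR K A₁ A₂ c}

def pevalC {A₁ A₂ : Finset Pt} (c : Coef K A₁ A₂)
    (p : MvPolynomial ({a // a ∈ A₁} ⊕ {a // a ∈ A₂}) K) : K :=
  MvPolynomial.eval (Sum.elim c.1 c.2) p

/-- Zariski closure in the space of coefficients. -/
def zclC {A₁ A₂ : Finset Pt} (S : Set (Coef K A₁ A₂)) : Set (Coef K A₁ A₂) :=
  {c | ∀ p : MvPolynomial ({a // a ∈ A₁} ⊕ {a // a ∈ A₂}) K,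
        (∀ s ∈ S, pevalC K s p = 0) → pevalC K c p = 0}

/-- zero set over `K` of an integer polynomial in the coefficients. -/
def zeroSetC {A₁ A₂ : Finset Pt} (Δ : MvPolynomial ({a // a ∈ A₁} ⊕ {a // a ∈ A₂}) ℤ) :
    Set (Coef K A₁ A₂) :=
  {c | pevalC K c (Δ.map (Int.castRingHom K)) = 0}

/-- `Δ` is the mixed discriminant of the pair `(A₁, A₂)`: an irreducible nonconstant
integer polynomial whose zero set is the Zariski closure of the mixed discriminantal
locus (so this closure is a hypersurface). -/
def IsMixedDisc (A₁ A₂ : Finset Pt)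
    (Δ : MvPolynomial ({a // a ∈ A₁} ⊕ {a // a ∈ A₂}) ℤ) : Prop :=
  Irreducible Δ ∧ 0 < Δ.totalDegree ∧
    zeroSetC K Δ = zclC K (discLocus K A₁ A₂)

/-- the pair `(A₁,A₂)` is defective: the discriminantal variety is not a hypersurface. -/
def DefectivePair (A₁ A₂ : Finset Pt) : Prop := ¬ ∃ Δ, IsMixedDisc K A₁ A₂ Δ

end Disc

/-- index in `ℤ⁴` of the span of the columns of the Cayley matrix of `(A₁, A₂)`. -/
def cayIdx (A₁ A₂ : Finset Pt) : ℕ :=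
  (AddSubgroup.closure
    ((fun a => ((((1:ℤ),(0:ℤ)) : Pt), a)) '' (A₁ : Set Pt) ∪
     (fun b => ((((0:ℤ),(1:ℤ)) : Pt), b)) '' (A₂ : Set Pt))).index

/-- `Δt` is the mixed discriminant cycle: the mixed discriminant raised to the power
`i(A)`, or `1` in the defective case. -/
def IsMixedDiscCycle (K : Type) [Field K] (A₁ A₂ : Finset Pt)
    (Δt : MvPolynomial ({a // a ∈ A₁} ⊕ {a // a ∈ A₂}) ℤ) : Prop :=
  (∃ Δ, IsMixedDisc K A₁ A₂ Δ ∧ Δt = Δ ^ cayIdx A₁ A₂) ∨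
    (DefectivePair K A₁ A₂ ∧ Δt = 1)

/-- degree in the block of variables indexed by the first configuration. -/
def blockDegL {A₁ A₂ : Finset Pt}
    (p : MvPolynomial ({a // a ∈ A₁} ⊕ {a // a ∈ A₂}) ℤ) : ℕ :=
  p.support.sup fun m => m.sum fun x k => if x.isLeft then k else 0

/-- degree in the block of variables indexed by the second configuration. -/
def blockDegR {A₁ A₂ : Finset Pt}
    (p : MvPolynomial ({a // a ∈ A₁} ⊕ {a // a ∈ A₂}) ℤ) : ℕ :=
  p.support.sup fun m => m.sum fun x k => if x.isRight then k else 0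

end

def coneOver (K : Set (ℝ × ℝ)) : Set (ℝ × ℝ) :=
  {x | ∃ t : ℝ, 0 ≤ t ∧ ∃ g ∈ K, x = t • g}

lemma zero_mem_coneOver {K : Set (ℝ × ℝ)} (hK : K.Nonempty) : (0 : ℝ × ℝ) ∈ coneOver K := by
  obtain ⟨g, hg⟩ := hK
  exact ⟨0, le_rfl, g, hg, by simp⟩

lemma smul_mem_coneOver {K : Set (ℝ × ℝ)} {c : ℝ} (hc : 0 ≤ c) {x : ℝ × ℝ}
    (hx : x ∈ coneOver K) : c • x ∈ coneOver K := by
  obtain ⟨t, ht, g, hg, rfl⟩ := hx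
  exact ⟨c * t, mul_nonneg hc ht, g, hg, smul_smul _ _ _⟩

lemma exists_smul_eq_smul_add_smul {K : Set (ℝ × ℝ)} (hK : Convex ℝ K) {s t : ℝ}
    (hs : 0 ≤ s) (ht : 0 ≤ t) {x y : ℝ × ℝ} (hx : x ∈ K) (hy : y ∈ K) :
    ∃ g ∈ K, s • x + t • y = (s + t) • g := by
  rcases (add_nonneg hs ht).eq_or_lt with h | h
  · have hs0 : s = 0 := by linarith
    have ht0 : t = 0 := by linarith
    exact ⟨x, hx, by simp [hs0, ht0]⟩
  · refine ⟨(s / (s + t)) • x + (t / (s + t)) • y,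
      hK hx hy (by positivity) (by positivity) (by field_simp), ?_⟩
    rw [smul_add, smul_smul, smul_smul, mul_div_cancel₀ _ h.ne', mul_div_cancel₀ _ h.ne']

lemma add_mem_coneOver {K : Set (ℝ × ℝ)} (hK : Convex ℝ K) {x y : ℝ × ℝ}
    (hx : x ∈ coneOver K) (hy : y ∈ coneOver K) : x + y ∈ coneOver K := by
  obtain ⟨s, hs, g, hg, rfl⟩ := hx
  obtain ⟨t, ht, h, hh, rfl⟩ := hy
  obtain ⟨k, hk, e⟩ := exists_smul_eq_smul_add_smul hK hs ht hg hh
  exact ⟨s + t, add_nonneg hs ht, k, hk, e⟩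

lemma convex_coneOver {K : Set (ℝ × ℝ)} (hK : Convex ℝ K) : Convex ℝ (coneOver K) :=
  fun _ hx _ hy _ _ ha hb _ =>
    add_mem_coneOver hK (smul_mem_coneOver ha hx) (smul_mem_coneOver hb hy)

lemma measurableSet_add_coneOver {K L : Set (ℝ × ℝ)} (hK : IsCompact K) (hL : IsCompact L) :
    MeasurableSet (L + coneOver K) := by
  have h : L + coneOver K = ⋃ n : ℕ, (L + Set.Icc (0 : ℝ) n • K) := by
    ext x
    simp only [Set.mem_iUnion, Set.mem_add, Set.mem_smul, Set.mem_Icc]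
    constructor
    · rintro ⟨l, hl, _, ⟨t, ht, g, hg, rfl⟩, rfl⟩
      obtain ⟨n, hn⟩ := exists_nat_ge t
      exact ⟨n, l, hl, _, ⟨t, ⟨ht, hn⟩, g, hg, rfl⟩, rfl⟩
    · rintro ⟨n, l, hl, _, ⟨t, ht, g, hg, rfl⟩, rfl⟩
      exact ⟨l, hl, _, ⟨t, ht.1, g, hg, rfl⟩, rfl⟩
  rw [h]
  exact MeasurableSet.iUnion fun n => (hL.add (isCompact_Icc.smul_set hK)).measurableSet

/-- Thickening a nonempty interval by a unit interval adds at least one to its length. -/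
lemma volume_add_one_le_volume_add_Icc {U : Set ℝ} (hU : U.OrdConnected) {x : ℝ} (hx : x ∈ U) :
    volume U + 1 ≤ volume (U + Set.Icc (0 : ℝ) 1) := by
  set L := U ∩ Set.Iic x
  set R := (fun y => y + (-1 : ℝ)) ⁻¹' (U ∩ Set.Ioi x)
  have hR : MeasurableSet R := (measurable_add_const _) (hU.measurableSet.inter measurableSet_Ioi)
  have hRv : volume R = volume (U ∩ Set.Ioi x) := measure_preimage_add_right _ _ _
  have h1 : volume U ≤ volume L + volume R := by
    rw [hRv]
    refine (measure_mono ?_).trans (measure_union_le _ _)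
    intro y hy
    rcases le_or_gt y x with h | h
    exacts [Or.inl ⟨hy, h⟩, Or.inr ⟨hy, h⟩]
  have h2 : volume (Set.Ioc x (x + 1)) = 1 := by simp
  have hd1 : Disjoint L R := by
    rw [Set.disjoint_left]
    rintro y ⟨_, hy⟩ ⟨_, hy'⟩
    simp only [Set.mem_Iic, Set.mem_Ioi] at hy hy'
    linarith
  have hd2 : Disjoint (L ∪ R) (Set.Ioc x (x + 1)) := by
    rw [Set.disjoint_left]
    rintro y (⟨_, hy⟩ | ⟨_, hy⟩) ⟨h3, h4⟩ <;> simp only [Set.mem_Iic, Set.mem_Ioi] at hy <;>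
      linarith
  calc volume U + 1 ≤ volume L + volume R + volume (Set.Ioc x (x + 1)) := by
        rw [h2]; gcongr
    _ = volume (L ∪ R ∪ Set.Ioc x (x + 1)) := by
        rw [measure_union hd2 measurableSet_Ioc, measure_union hd1 hR]
    _ ≤ _ := by
        refine measure_mono ?_
        rintro y ((⟨hy, _⟩ | ⟨hy, _⟩) | ⟨h3, h4⟩)
        · exact ⟨y, hy, 0, by simp, by simp⟩
        · exact ⟨_, hy, 1, by simp, by simp⟩
        · exact ⟨x, hx, y - x, ⟨by linarith, by linarith⟩, by simp⟩

lemma volume_diff_le_volume_add_Icc_diff {U V : Set ℝ} (hU : U.OrdConnected)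
    (hV : V.OrdConnected) (hVne : V.Nonempty) :
    volume (U \ V) ≤ volume ((U + Set.Icc (0 : ℝ) 1) \ (V + Set.Icc (0 : ℝ) 1)) := by
  obtain ⟨z, hz⟩ := hVne
  set R₀ := U ∩ {x | ∀ y ∈ V, y < x}
  set L := U ∩ {x | ∀ y ∈ V, x < y}
  set R := (fun y => y + (-1 : ℝ)) ⁻¹' R₀
  have hR₀ : MeasurableSet R₀ := by
    refine (hU.inter ⟨?_⟩).measurableSet
    intro a ha b _ c hc y hy
    exact (ha y hy).trans_le hc.1
  have hR : MeasurableSet R := (measurable_add_const _) hR₀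
  have hRv : volume R = volume R₀ := measure_preimage_add_right _ _ _
  have hd : Disjoint L R := by
    rw [Set.disjoint_left]
    rintro y ⟨_, hy⟩ ⟨_, hy'⟩
    have h1 := hy z hz
    have h2 := hy' z hz
    linarith
  calc volume (U \ V) ≤ volume (L ∪ R₀) := by
        refine measure_mono ?_
        rintro x ⟨hx, hxV⟩
        by_contra hcon
        simp only [L, R₀, Set.mem_union, Set.mem_inter_iff, hx, true_and, Set.mem_ofPred_eq,
          not_or, not_forall, not_lt] at hcon
        obtain ⟨⟨a, ha, ha'⟩, b, hb, hb'⟩ := hcon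
        exact hxV (hV.out ha hb ⟨ha', hb'⟩)
    _ ≤ volume L + volume R := by rw [hRv]; exact measure_union_le _ _
    _ = volume (L ∪ R) := (measure_union hd hR).symm
    _ ≤ _ := by
        refine measure_mono ?_
        rintro y (⟨hy, h⟩ | ⟨hy, h⟩)
        · refine ⟨⟨y, hy, 0, by simp, by simp⟩, ?_⟩
          rintro ⟨v, hv, r, hr, e⟩
          have h1 := h v hv
          have h2 := hr.1
          simp only at e
          linarith
        · refine ⟨⟨_, hy, 1, by simp, by simp⟩, ?_⟩
          rintro ⟨v, hv, r, hr, e⟩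
          have h1 := h v hv
          have h2 := hr.2
          simp only at e
          linarith

/-- Adding a vertical unit segment to two nested convex sets enlarges their difference at least by
the width of any set of vertical lines meeting the larger set but not the smaller one. -/
lemma volume_diff_add_le_of_vertical {U V : Set (ℝ × ℝ)} (hU : Convex ℝ U) (hV : Convex ℝ V)
    (hUm : MeasurableSet U) (hVm : MeasurableSet V) {a d : ℝ}
    (hUa : ∀ l ∈ Set.Ico a (a + d), ∃ s, (l, s) ∈ U)
    (hVa : ∀ l ∈ Set.Ico a (a + d), ∀ s, (l, s) ∉ V) :
    volume (U \ V) + ENNReal.ofReal d ≤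
      volume ((U + {0} ×ˢ Set.Icc (0 : ℝ) 1) \ (V + {0} ×ˢ Set.Icc (0 : ℝ) 1)) := by
  set I : Set (ℝ × ℝ) := {0} ×ˢ Set.Icc (0 : ℝ) 1
  have hslice : ∀ (X : Set (ℝ × ℝ)) (l : ℝ),
      Prod.mk l ⁻¹' (X + I) = Prod.mk l ⁻¹' X + Set.Icc (0 : ℝ) 1 := by
    intro X l
    ext s
    constructor
    · rintro ⟨⟨x1, x2⟩, hx, ⟨i1, i2⟩, ⟨hi1, hi2⟩, e⟩
      simp only [Set.mem_singleton_iff] at hi1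
      simp only [Prod.mk_add_mk, Prod.mk.injEq] at e
      obtain ⟨rfl, rfl⟩ := e
      subst hi1
      exact ⟨x2, by simpa using hx, i2, hi2, rfl⟩
    · rintro ⟨x, hx, i, hi, rfl⟩
      exact ⟨(l, x), hx, (0, i), ⟨rfl, hi⟩, by simp⟩
  have hord : ∀ {X : Set (ℝ × ℝ)}, Convex ℝ X → ∀ l, (Prod.mk l ⁻¹' X).OrdConnected := by
    intro X hX l
    refine Convex.ordConnected ?_
    intro x hx y hy p q hp hq hpq
    have := hX hx hy hp hq hpq
    simp only [Set.mem_preimage] at *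
    convert this using 1
    ext
    · simp only [Prod.smul_mk, Prod.mk_add_mk, smul_eq_mul]
      rw [← add_mul, hpq, one_mul]
    · simp
  set T := toMeasurable volume ((U + I) \ (V + I))
  have hT : (U + I) \ (V + I) ⊆ T := subset_toMeasurable _ _
  rw [← measure_toMeasurable ((U + I) \ (V + I)), Measure.volume_eq_prod,
    Measure.prod_apply (hUm.diff hVm), Measure.prod_apply (measurableSet_toMeasurable _ _)]
  have hind : ENNReal.ofReal d = ∫⁻ l, (Set.Ico a (a + d)).indicator 1 l := by
    rw [lintegral_indicator_one measurableSet_Ico]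
    simp
  rw [hind, ← lintegral_add_right _ (measurable_one.indicator measurableSet_Ico)]
  refine lintegral_mono fun l => ?_
  refine le_trans ?_ (measure_mono (Set.preimage_mono (f := Prod.mk l) hT))
  rw [Set.preimage_sdiff, Set.preimage_sdiff, hslice, hslice]
  rcases (Prod.mk l ⁻¹' V).eq_empty_or_nonempty with h | h
  · rw [h, Set.empty_add, Set.sdiff_empty, Set.sdiff_empty]
    by_cases hl : l ∈ Set.Ico a (a + d)
    · obtain ⟨s, hs⟩ := hUa l hl
      simpa [Set.indicator_of_mem hl] using
        volume_add_one_le_volume_add_Icc (hord hU l) (x := s) hs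
    · rw [Set.indicator_of_notMem hl, add_zero]
      exact measure_mono fun x hx => ⟨x, hx, 0, by simp, by simp⟩
  · have hl : l ∉ Set.Ico a (a + d) := fun hl => by
      obtain ⟨s, hs⟩ := h
      exact hVa l hl s hs
    rw [Set.indicator_of_notMem hl, add_zero]
    exact volume_diff_le_volume_add_Icc_diff (hord hU l) (hord hV l) h

def dotR (w x : ℝ × ℝ) : ℝ := w.1 * x.1 + w.2 * x.2

/-- Rotation by a quarter turn. -/
def quarterTurn (w : ℝ × ℝ) : ℝ × ℝ := (-w.2, w.1)

lemma dotR_add (w x y : ℝ × ℝ) : dotR w (x + y) = dotR w x + dotR w y := by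
  simp only [dotR, Prod.fst_add, Prod.snd_add]; ring

lemma dotR_sub (w x y : ℝ × ℝ) : dotR w (x - y) = dotR w x - dotR w y := by
  simp only [dotR, Prod.fst_sub, Prod.snd_sub]; ring

lemma dotR_smul (w : ℝ × ℝ) (c : ℝ) (x : ℝ × ℝ) : dotR w (c • x) = c * dotR w x := by
  simp only [dotR, Prod.smul_fst, Prod.smul_snd, smul_eq_mul]; ring

lemma dotR_add_smul_left (v w : ℝ × ℝ) (c : ℝ) (x : ℝ × ℝ) :
    dotR (v + c • w) x = dotR v x + c * dotR w x := by
  simp only [dotR, Prod.fst_add, Prod.snd_add, Prod.smul_fst, Prod.smul_snd, smul_eq_mul]; ring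

lemma dotR_quarterTurn_self (w : ℝ × ℝ) : dotR w (quarterTurn w) = 0 := by
  simp only [dotR, quarterTurn]; ring

lemma convex_dotR_ge (w : ℝ × ℝ) (c : ℝ) : Convex ℝ {x | c ≤ dotR w x} := by
  intro x hx y hy a b ha hb hab
  have hx' : c ≤ dotR w x := hx
  have hy' : c ≤ dotR w y := hy
  change c ≤ dotR w (a • x + b • y)
  rw [dotR_add, dotR_smul, dotR_smul]
  calc c = a * c + b * c := by rw [← add_mul, hab, one_mul]
    _ ≤ _ := by gcongr

lemma exists_smul_quarterTurn {w u x : ℝ × ℝ} (hwu : dotR w u ≠ 0) (hx : dotR w x = 0) :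
    ∃ c : ℝ, x = c • quarterTurn w := by
  have hw : w.1 ^ 2 + w.2 ^ 2 ≠ 0 := by
    intro h
    have h1 : w.1 = 0 := by nlinarith [sq_nonneg w.1, sq_nonneg w.2]
    have h2 : w.2 = 0 := by nlinarith [sq_nonneg w.1, sq_nonneg w.2]
    simp [dotR, h1, h2] at hwu
  simp only [dotR] at hx
  refine ⟨(w.1 * x.2 - w.2 * x.1) / (w.1 ^ 2 + w.2 ^ 2), ?_⟩
  ext
  · simp only [quarterTurn, Prod.smul_fst, smul_eq_mul]
    field_simp
    linear_combination w.1 * hx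
  · simp only [quarterTurn, Prod.smul_snd, smul_eq_mul]
    field_simp
    linear_combination w.2 * hx

/-- Adding a segment to two nested convex sets enlarges their difference by at least the area of
the strip between their supporting lines parallel to the segment. -/
lemma volume_diff_add_le_of_segment {U V : Set (ℝ × ℝ)} (hU : Convex ℝ U) (hV : Convex ℝ V)
    (hUm : MeasurableSet U) (hVm : MeasurableSet V) {w q u : ℝ × ℝ} {n δ : ℝ} (hn : 0 < n)
    (hwu : 0 < dotR w u) (hq : ∀ l : ℝ, 0 ≤ l → q + l • u ∈ U)
    (hδ : ∀ x ∈ V, dotR w q + δ ≤ dotR w x) :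
    volume (U \ V) + ENNReal.ofReal (n * δ) ≤
      volume ((U + (fun r : ℝ => r • n • quarterTurn w) '' Set.Icc 0 1) \
        (V + (fun r : ℝ => r • n • quarterTurn w) '' Set.Icc 0 1)) := by
  set e : ℝ × ℝ := n • quarterTurn w with he
  set φ : (ℝ × ℝ) →ₗ[ℝ] (ℝ × ℝ) := Matrix.toLin (Module.Basis.finTwoProd ℝ)
    (Module.Basis.finTwoProd ℝ) !![u.1, e.1; u.2, e.2] with hφ
  have hφa : ∀ x, φ x = x.1 • u + x.2 • e := by
    intro x
    rw [hφ, Matrix.toLin_finTwoProd_apply]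
    ext <;> simp <;> ring
  have hdet : LinearMap.det φ = n * dotR w u := by
    rw [hφ, LinearMap.det_toLin, Matrix.det_fin_two_of]
    simp only [he, quarterTurn, dotR, Prod.smul_fst, Prod.smul_snd, smul_eq_mul]
    ring
  have hk : 0 < n * dotR w u := mul_pos hn hwu
  have hvol : ∀ X : Set (ℝ × ℝ),
      volume X = ENNReal.ofReal (n * dotR w u) * volume (φ ⁻¹' X) := by
    intro X
    rw [Measure.addHaar_preimage_linearMap _ (by rw [hdet]; exact hk.ne'), hdet, ← mul_assoc,
      ← ENNReal.ofReal_mul hk.le, abs_of_pos (inv_pos.2 hk), mul_inv_cancel₀ hk.ne']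
    simp
  have hadd : ∀ X : Set (ℝ × ℝ), φ ⁻¹' (X + (fun r : ℝ => r • e) '' Set.Icc 0 1) =
      φ ⁻¹' X + {0} ×ˢ Set.Icc (0 : ℝ) 1 := by
    intro X
    ext x
    constructor
    · rintro ⟨y, hy, _, ⟨r, hr, rfl⟩, h⟩
      refine ⟨x - (0, r), ?_, (0, r), ⟨rfl, hr⟩, by simp⟩
      have : φ (x - (0, r)) = y := by
        rw [map_sub, ← h, hφa (0, r)]
        simp
      rwa [Set.mem_preimage, this]
    · rintro ⟨y, hy, ⟨_, r⟩, ⟨hz, hr⟩, rfl⟩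
      simp only [Set.mem_singleton_iff] at hz
      subst hz
      refine ⟨φ y, hy, r • e, ⟨r, hr, rfl⟩, ?_⟩
      rw [map_add, hφa (0, r)]
      simp
  have hφm : Measurable φ := φ.continuous_of_finiteDimensional.measurable
  have hdot : ∀ x, dotR w (φ x) = x.1 * dotR w u := by
    intro x
    rw [hφa, dotR_add, dotR_smul, dotR_smul, he, dotR_smul, dotR_quarterTurn_self]
    ring
  have key := volume_diff_add_le_of_vertical (hU.linear_preimage φ) (hV.linear_preimage φ)
    (hφm hUm) (hφm hVm) (a := dotR w q / dotR w u) (d := δ / dotR w u) ?_ ?_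
  · rw [hvol (U \ V), hvol ((U + _) \ _), Set.preimage_sdiff, Set.preimage_sdiff, hadd, hadd]
    have h2 : ENNReal.ofReal (n * δ) =
        ENNReal.ofReal (n * dotR w u) * ENNReal.ofReal (δ / dotR w u) := by
      rw [← ENNReal.ofReal_mul hk.le]
      congr 1
      field_simp
    rw [h2, ← mul_add]
    gcongr
  · rintro l ⟨hl, -⟩
    have hx : dotR w (q - (dotR w q / dotR w u) • u) = 0 := by
      rw [dotR_sub, dotR_smul, div_mul_cancel₀ _ hwu.ne', sub_self]
    obtain ⟨c, hc⟩ := exists_smul_quarterTurn hwu.ne' hx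
    refine ⟨c / n, ?_⟩
    have h3 : φ (l, c / n) = q + (l - dotR w q / dotR w u) • u := by
      rw [hφa, he, smul_smul, div_mul_cancel₀ _ hn.ne', ← hc]
      module
    rw [Set.mem_preimage, h3]
    exact hq _ (sub_nonneg.2 hl)
  · rintro l ⟨-, hl⟩ s hs
    have h4 := hδ _ hs
    rw [hdot] at h4
    rw [← add_div, lt_div_iff₀ hwu] at hl
    linarith

lemma Convex.add_smul_mem_of_le {X : Set (ℝ × ℝ)} (hX : Convex ℝ X) {y e : ℝ × ℝ} {c r : ℝ}
    (hy : y ∈ X) (hc : y + c • e ∈ X) (hr : 0 ≤ r) (hrc : r ≤ c) : y + r • e ∈ X := by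
  rcases hr.eq_or_lt with rfl | hr'
  · simpa using hy
  · have hc0 : 0 < c := hr'.trans_le hrc
    have := hX.add_smul_mem hy hc (t := r / c) ⟨by positivity, (div_le_one hc0).2 hrc⟩
    rwa [smul_smul, div_mul_cancel₀ _ hc0.ne'] at this

/-- An edge of a finite planar set facing away from a cone can be contracted to a point, so that
modulo the cone the hull is the sum of the contracted hull and the edge. -/
lemma exists_contract_edge {K : Set (ℝ × ℝ)} (hK : Convex ℝ K) (hKne : K.Nonempty)
    (B : Finset (ℝ × ℝ)) {w q : ℝ × ℝ} {n : ℝ} (hn : 0 < n) (hw : ∀ g ∈ K, 0 < dotR w g)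
    (hq : q ∈ B) (hq' : q + n • quarterTurn w ∈ B) (hmin : ∀ b ∈ B, dotR w q ≤ dotR w b) :
    ∃ B₁ : Finset (ℝ × ℝ), q ∈ B₁ ∧ B₁.card < B.card ∧ (∀ b ∈ B₁, dotR w q ≤ dotR w b) ∧
      convexHull ℝ (B : Set (ℝ × ℝ)) + coneOver K = convexHull ℝ (B₁ : Set (ℝ × ℝ)) +
        coneOver K + (fun r : ℝ => r • n • quarterTurn w) '' Set.Icc 0 1 ∧
      ∀ w', (∀ g ∈ K, 0 < dotR w' g) → dotR w' (quarterTurn w) ≠ 0 → ∀ p ∈ B, ∀ f, p + f ∈ B →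
        dotR w' f = 0 → (∀ b ∈ B, dotR w' p ≤ dotR w' b) →
        ∃ p₁ ∈ B₁, p₁ + f ∈ B₁ ∧ ∀ b ∈ B₁, dotR w' p₁ ≤ dotR w' b := by
  obtain ⟨u, hu⟩ := hKne
  have hwu := hw u hu
  set e : ℝ × ℝ := n • quarterTurn w with he
  have hwe : dotR w e = 0 := by rw [he, dotR_smul, dotR_quarterTurn_self, mul_zero]
  set s : ℝ × ℝ → ℝ := fun b =>
    ((b - q).2 * u.1 - (b - q).1 * u.2) / (n * dotR w u) with hs
  set l : ℝ × ℝ → ℝ := fun b => dotR w (b - q) / dotR w u with hl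
  have hdec : ∀ b, b = q + s b • e + l b • u := by
    intro b
    have h0 : w.1 * u.1 + w.2 * u.2 ≠ 0 := hwu.ne'
    ext
    · simp only [hs, hl, he, quarterTurn, dotR, Prod.fst_add, Prod.smul_fst, smul_eq_mul,
        Prod.fst_sub, Prod.snd_sub]
      generalize hD : w.1 * u.1 + w.2 * u.2 = D at h0 ⊢
      field_simp
      rw [← hD]
      ring
    · simp only [hs, hl, he, quarterTurn, dotR, Prod.snd_add, Prod.smul_snd, smul_eq_mul,
        Prod.fst_sub, Prod.snd_sub]
      generalize hD : w.1 * u.1 + w.2 * u.2 = D at h0 ⊢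
      field_simp
      rw [← hD]
      ring
  have hsq : s q = 0 := by simp [hs]
  have hsq' : s (q + e) = 1 := by
    simp only [hs, add_sub_cancel_left]
    rw [div_eq_one_iff_eq (mul_pos hn hwu).ne']
    simp only [he, quarterTurn, dotR, Prod.smul_fst, Prod.smul_snd, smul_eq_mul]
    ring
  have hl0 : ∀ b ∈ B, 0 ≤ l b := fun b hb =>
    div_nonneg (by rw [dotR_sub]; linarith [hmin b hb]) hwu.le
  set cl : ℝ × ℝ → ℝ := fun b => max 0 (min 1 (s b)) with hcl
  have hcl0 : ∀ b, 0 ≤ cl b := fun b => le_max_left _ _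
  have hcl1 : ∀ b, cl b ≤ 1 := fun b => max_le zero_le_one (min_le_left _ _)
  set τ : ℝ × ℝ → ℝ × ℝ := fun b => b - cl b • e with hτ
  have hτq : τ q = q := by simp [hτ, hcl, hsq]
  have hτq' : τ (q + e) = q := by simp [hτ, hcl, hsq']
  have hene : e ≠ 0 := by
    intro h
    rw [h, add_zero, hsq] at hsq'
    exact zero_ne_one hsq'
  set C := coneOver K
  set X := convexHull ℝ (B : Set (ℝ × ℝ)) + C with hX
  have hXc : Convex ℝ X := (convex_convexHull ℝ _).add (convex_coneOver hK)
  have hBX : ∀ b ∈ B, ∀ c ∈ C, b + c ∈ X := fun b hb c hc =>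
    Set.add_mem_add (subset_convexHull ℝ _ hb) hc
  have hC0 : (0 : ℝ × ℝ) ∈ C := zero_mem_coneOver ⟨u, hu⟩
  have hluC : ∀ b ∈ B, l b • u ∈ C := fun b hb => ⟨l b, hl0 b hb, u, hu, rfl⟩
  have hτX : ∀ b ∈ B, ∀ r ∈ Set.Icc (0 : ℝ) 1, τ b + r • e ∈ X := by
    rintro b hb r ⟨hr0, hr1⟩
    have hx0 : q + l b • u ∈ X := hBX q hq _ (hluC b hb)
    have hx1 : q + e + l b • u ∈ X := hBX _ hq' _ (hluC b hb)
    have hxb : b ∈ X := by simpa using hBX b hb 0 hC0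
    rcases lt_or_ge (s b) 0 with h | h
    · have : cl b = 0 := by
        simp only [hcl]; rw [min_eq_right (by linarith), max_eq_left h.le]
      simp only [hτ, this, zero_smul, sub_zero]
      refine hXc.add_smul_mem_of_le (c := 1 - s b) hxb ?_ hr0 (by linarith)
      convert hx1 using 1
      nth_rewrite 1 [hdec b]
      module
    rcases le_or_gt (s b) 1 with h' | h'
    · have : cl b = s b := by
        simp only [hcl]; rw [min_eq_right h', max_eq_right h]
      have h5 : τ b + r • e = (q + l b • u) + r • e := by
        simp only [hτ, this]
        nth_rewrite 1 [hdec b]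
        module
      rw [h5]
      refine hXc.add_smul_mem_of_le (c := 1) hx0 ?_ hr0 hr1
      convert hx1 using 1
      module
    · have : cl b = 1 := by
        simp only [hcl]; rw [min_eq_left h'.le, max_eq_right zero_le_one]
      have h5 : τ b + r • e = (q + l b • u) + (s b - 1 + r) • e := by
        simp only [hτ, this]
        nth_rewrite 1 [hdec b]
        module
      rw [h5]
      refine hXc.add_smul_mem_of_le (c := s b) hx0 ?_ (by linarith) (by linarith)
      convert hxb using 1
      nth_rewrite 3 [hdec b]
      module
  refine ⟨B.image τ, ?_, ?_, ?_, ?_, ?_⟩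
  · exact Finset.mem_image.2 ⟨q, hq, hτq⟩
  · refine lt_of_le_of_ne Finset.card_image_le fun h => ?_
    have := Finset.card_image_iff.1 h hq hq' (hτq.trans hτq'.symm)
    exact hene (by simpa using this)
  · intro b hb
    obtain ⟨b, hbB, rfl⟩ := Finset.mem_image.1 hb
    simp only [hτ]
    rw [dotR_sub, dotR_smul, hwe]
    linarith [hmin b hbB]
  · set S := (fun r : ℝ => r • e) '' Set.Icc 0 1 with hS
    have hSc : Convex ℝ S :=
      (convex_Icc (0 : ℝ) 1).is_linear_image (LinearMap.toSpanSingleton ℝ _ e).isLinear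
    apply Set.Subset.antisymm
    · rw [add_right_comm]
      refine Set.add_subset_add_right (convexHull_min ?_ ((convex_convexHull ℝ _).add hSc))
      intro b hb
      refine ⟨τ b, subset_convexHull ℝ _ (Finset.mem_coe.2 (Finset.mem_image_of_mem τ hb)),
        cl b • e, ⟨cl b, ⟨hcl0 b, hcl1 b⟩, rfl⟩, by simp [hτ]⟩
    · have h6 : convexHull ℝ ((B.image τ : Finset (ℝ × ℝ)) : Set (ℝ × ℝ)) ⊆
          {x | ∀ r ∈ Set.Icc (0 : ℝ) 1, x + r • e ∈ X} := by
        refine convexHull_min ?_ ?_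
        · intro x hx
          obtain ⟨b, hb, rfl⟩ := Finset.mem_image.1 (Finset.mem_coe.1 hx)
          exact hτX b hb
        · intro x hx y hy a b ha hb hab r hr
          convert hXc (hx r hr) (hy r hr) ha hb hab using 1
          have : r • e = (a + b) • r • e := by rw [hab, one_smul]
          nth_rewrite 1 [this]
          module
      rintro _ ⟨_, ⟨x, hx, c, hc, rfl⟩, _, ⟨r, hr, rfl⟩, rfl⟩
      obtain ⟨y, hy, c', hc', h7⟩ := h6 hx r hr
      refine ⟨y, hy, c' + c, add_mem_coneOver hK hc' hc, ?_⟩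
      simp only at h7 ⊢
      rw [← add_assoc, h7]
      abel
  · intro w' hw' hne p hp f hpf hf hpmin
    have hXmin : ∀ x ∈ X, dotR w' p ≤ dotR w' x := by
      rintro _ ⟨x, hx, _, ⟨t, ht, g, hg, rfl⟩, rfl⟩
      have h8 : convexHull ℝ (B : Set (ℝ × ℝ)) ⊆ {x | dotR w' p ≤ dotR w' x} :=
        convexHull_min hpmin (convex_dotR_ge w' _)
      have h9 : dotR w' p ≤ dotR w' x := h8 hx
      change dotR w' p ≤ dotR w' (x + t • g)
      rw [dotR_add, dotR_smul]
      have := mul_nonneg ht (hw' g hg).le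
      linarith
    set σ := dotR w' e with hσdef
    have hσ : σ ≠ 0 := by
      rw [hσdef, he, dotR_smul]
      exact mul_ne_zero hn.ne' hne
    have hval : ∀ b ∈ B, dotR w' q + s b * σ ≤ dotR w' b := by
      intro b hb
      nth_rewrite 2 [hdec b]
      rw [dotR_add, dotR_add, dotR_smul w' (s b) e, dotR_smul w' (l b) u]
      have := mul_nonneg (hl0 b hb) (hw' u hu).le
      linarith
    have hpf' : ∀ b ∈ B, dotR w' (p + f) ≤ dotR w' b := by
      rw [dotR_add, hf, add_zero]; exact hpmin
    obtain ⟨r, hr, hrcl⟩ : ∃ r ∈ Set.Icc (0 : ℝ) 1, ∀ p' ∈ B,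
        (∀ b ∈ B, dotR w' p' ≤ dotR w' b) → cl p' = r := by
      rcases lt_or_gt_of_ne hσ with h | h
      · refine ⟨1, by simp, fun p' hp' hm => ?_⟩
        have h10 : 1 ≤ s p' := by
          have h11 := hval p' hp'
          have h12 := hm _ hq'
          rw [dotR_add] at h12
          by_contra hcon
          nlinarith
        simp only [hcl]
        rw [min_eq_left h10, max_eq_right zero_le_one]
      · refine ⟨0, by simp, fun p' hp' hm => ?_⟩
        have h10 : s p' ≤ 0 := by
          have h11 := hval p' hp'
          have h12 := hm _ hq
          by_contra hcon
          nlinarith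
        simp only [hcl]
        rw [min_eq_right (by linarith), max_eq_left h10]
    refine ⟨τ p, Finset.mem_image_of_mem τ hp, ?_, ?_⟩
    · have : τ p + f = τ (p + f) := by
        simp only [hτ]
        rw [hrcl p hp hpmin, hrcl _ hpf hpf']
        abel
      rw [this]
      exact Finset.mem_image_of_mem τ hpf
    · intro b hb
      obtain ⟨b, hbB, rfl⟩ := Finset.mem_image.1 hb
      have h13 := hXmin _ (hτX b hbB r hr)
      rw [dotR_add, dotR_smul] at h13
      have h14 : dotR w' (τ p) = dotR w' p - r * σ := by
        simp only [hτ]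
        rw [hrcl p hp hpmin, dotR_sub, dotR_smul]
      linarith

lemma exists_dotR_pos {K : Set (ℝ × ℝ)} (hK : Convex ℝ K) (hKc : IsClosed K)
    (h0 : (0 : ℝ × ℝ) ∉ K) : ∃ w : ℝ × ℝ, ∀ g ∈ K, 0 < dotR w g := by
  obtain ⟨f, c, hc, hf⟩ := geometric_hahn_banach_point_closed hK hKc h0
  refine ⟨(f (1, 0), f (0, 1)), fun g hg => ?_⟩
  have h1 : g = g.1 • ((1 : ℝ), (0 : ℝ)) + g.2 • ((0 : ℝ), (1 : ℝ)) := by ext <;> simp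
  have h2 : f g = dotR (f (1, 0), f (0, 1)) g := by
    nth_rewrite 1 [h1]
    rw [map_add, map_smul, map_smul]
    simp only [dotR, smul_eq_mul]
    ring
  rw [← h2]
  rw [map_zero] at hc
  exact hc.trans (hf g hg)

/-- A finite planar set none of whose edges faces away from the cone lies in a translate of the
cone with apex one of its points. -/
lemma exists_sub_mem_coneOver {G : Set (ℝ × ℝ)} (hG : G.Finite) (hGne : G.Nonempty)
    (h0 : (0 : ℝ × ℝ) ∉ convexHull ℝ G) {B : Finset (ℝ × ℝ)} (hB : B.Nonempty)
    (hedge : ∀ (w q : ℝ × ℝ) (n : ℝ), (∀ g ∈ convexHull ℝ G, 0 < dotR w g) → 0 < n → q ∈ B →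
      q + n • quarterTurn w ∈ B → ¬ ∀ b ∈ B, dotR w q ≤ dotR w b) :
    ∃ q ∈ B, ∀ b ∈ B, b - q ∈ coneOver (convexHull ℝ G) := by
  obtain ⟨w₀, hw₀⟩ := exists_dotR_pos (convex_convexHull ℝ G) (hG.isClosed_convexHull ℝ) h0
  obtain ⟨q, hq, hqmin⟩ := B.exists_min_image (dotR w₀) hB
  refine ⟨q, hq, fun b hb => ?_⟩
  by_contra hbC
  have hx : (0 : ℝ × ℝ) ∉ convexHull ℝ (insert (-(b - q)) G) := by
    rw [convexHull_insert hGne, mem_convexJoin]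
    rintro ⟨_, rfl, g, hg, α, β, hα, hβ, hαβ, h⟩
    rcases hα.eq_or_lt with rfl | hα'
    · rw [zero_add] at hαβ
      rw [hαβ, zero_smul, zero_add, one_smul] at h
      exact h0 (h ▸ hg)
    · refine hbC ⟨β / α, by positivity, g, hg, ?_⟩
      have h1 : α • (b - q) = β • g := by
        rw [smul_neg, neg_add_eq_zero] at h
        exact h
      rw [div_eq_inv_mul, mul_smul, ← h1, smul_smul, inv_mul_cancel₀ hα'.ne', one_smul]
  obtain ⟨w₁, hw₁⟩ := exists_dotR_pos (convex_convexHull ℝ _)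
    ((hG.insert _).isClosed_convexHull ℝ) hx
  have hw₁G : ∀ g ∈ convexHull ℝ G, 0 < dotR w₁ g := fun g hg =>
    hw₁ g (convexHull_mono (Set.subset_insert _ _) hg)
  have hb₁ : dotR w₁ b < dotR w₁ q := by
    have := hw₁ _ (subset_convexHull ℝ _ (Set.mem_insert _ _))
    rw [neg_sub, dotR_sub] at this
    linarith
  obtain ⟨c, hcF, hcmin⟩ := (B.filter fun b => dotR w₁ b < dotR w₁ q).exists_min_image
    (fun b => (dotR w₀ b - dotR w₀ q) / (dotR w₁ q - dotR w₁ b))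
    ⟨b, Finset.mem_filter.2 ⟨hb, hb₁⟩⟩
  obtain ⟨hc, hcq⟩ := Finset.mem_filter.1 hcF
  set ρ := (dotR w₀ c - dotR w₀ q) / (dotR w₁ q - dotR w₁ c) with hρ
  have hρ0 : 0 ≤ ρ := div_nonneg (by linarith [hqmin c hc]) (by linarith)
  set w := w₀ + ρ • w₁ with hw
  have hwG : ∀ g ∈ convexHull ℝ G, 0 < dotR w g := by
    intro g hg
    rw [hw, dotR_add_smul_left]
    have := mul_nonneg hρ0 (hw₁G g hg).le
    linarith [hw₀ g hg]
  have hmin : ∀ b ∈ B, dotR w q ≤ dotR w b := by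
    intro b hb
    rw [hw, dotR_add_smul_left, dotR_add_smul_left]
    have h1 := hqmin b hb
    rcases lt_or_ge (dotR w₁ b) (dotR w₁ q) with h | h
    · have h2 := hcmin b (Finset.mem_filter.2 ⟨hb, h⟩)
      rw [le_div_iff₀ (by linarith)] at h2
      linarith
    · have := mul_le_mul_of_nonneg_left h hρ0
      linarith
  have heq : dotR w c = dotR w q := by
    rw [hw, dotR_add_smul_left, dotR_add_smul_left]
    have h3 : ρ * (dotR w₁ q - dotR w₁ c) = dotR w₀ c - dotR w₀ q :=
      div_mul_cancel₀ _ (by linarith)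
    linarith
  obtain ⟨g, hg⟩ := hGne
  obtain ⟨κ, hκ⟩ := exists_smul_quarterTurn (hwG g (subset_convexHull ℝ _ hg)).ne'
    (show dotR w (c - q) = 0 by rw [dotR_sub, heq, sub_self])
  rcases lt_trichotomy κ 0 with h | h | h
  · refine hedge w c (-κ) hwG (by linarith) hc ?_ (by rw [heq]; exact hmin)
    rwa [neg_smul, ← hκ, neg_sub, add_sub_cancel]
  · rw [h, zero_smul, sub_eq_zero] at hκ
    rw [hκ] at hcq
    exact lt_irrefl _ hcq
  · refine hedge w q κ hwG h hq ?_ hmin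
    rwa [← hκ, add_sub_cancel]

/-- The area cut off from `conv B + C` by adding a convex set `K` generating the cone `C` is at
least the area cut off from `C` plus the lengths of the edges of `B` facing away from `C`. -/
theorem volume_cone_diff_add_sum_le {G : Set (ℝ × ℝ)} (hG : G.Finite) (hGne : G.Nonempty)
    (h0 : (0 : ℝ × ℝ) ∉ convexHull ℝ G) (B : Finset (ℝ × ℝ)) (hB : B.Nonempty)
    (W : Finset (ℝ × ℝ)) (n : ℝ × ℝ → ℝ)
    (hW : ∀ w ∈ W, ∀ g ∈ convexHull ℝ G, 1 ≤ dotR w g)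
    (hWW : ∀ w ∈ W, ∀ w' ∈ W, w' ≠ w → dotR w' (quarterTurn w) ≠ 0)
    (hn : ∀ w ∈ W, 0 ≤ n w)
    (hnB : ∀ w ∈ W, ∃ p ∈ B, p + n w • quarterTurn w ∈ B ∧ ∀ b ∈ B, dotR w p ≤ dotR w b) :
    volume (coneOver (convexHull ℝ G) \ (coneOver (convexHull ℝ G) + convexHull ℝ G)) +
        ∑ w ∈ W, ENNReal.ofReal (n w) ≤
      volume ((convexHull ℝ (B : Set (ℝ × ℝ)) + coneOver (convexHull ℝ G)) \
        (convexHull ℝ (B : Set (ℝ × ℝ)) + coneOver (convexHull ℝ G) + convexHull ℝ G)) := by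
  induction hcard : B.card using Nat.strong_induction_on generalizing B W with
  | _ N ih =>
  set K := convexHull ℝ G with hKdef
  have hKconv : Convex ℝ K := convex_convexHull ℝ G
  have hKcomp : IsCompact K := hG.isCompact_convexHull ℝ
  have hKne : K.Nonempty := hGne.convexHull
  set C := coneOver K with hC
  have hCconv : Convex ℝ C := convex_coneOver hKconv
  have step : ∀ (W' : Finset (ℝ × ℝ)) (w q : ℝ × ℝ) (m δ : ℝ), W' ⊆ W →
      (∀ w' ∈ W', dotR w' (quarterTurn w) ≠ 0) → (∀ g ∈ K, 0 < dotR w g) →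
      (∀ g ∈ K, δ ≤ dotR w g) → 0 < m → q ∈ B → q + m • quarterTurn w ∈ B →
      (∀ b ∈ B, dotR w q ≤ dotR w b) →
      volume (C \ (C + K)) + ∑ w ∈ W', ENNReal.ofReal (n w) + ENNReal.ofReal (m * δ) ≤
      volume ((convexHull ℝ (B : Set (ℝ × ℝ)) + C) \
        (convexHull ℝ (B : Set (ℝ × ℝ)) + C + K)) := by
    intro W' w q m δ hW' hW'w hwK hδ hm hq hq' hmin
    obtain ⟨B₁, hqB₁, hlt, hmin₁, hsum, hedges⟩ :=
      exists_contract_edge hKconv hKne B hm hwK hq hq' hmin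
    have h1 := ih B₁.card (hcard ▸ hlt) B₁ ⟨q, hqB₁⟩ W' (fun w hw => hW w (hW' hw))
      (fun w hw w' hw' => hWW w (hW' hw) w' (hW' hw')) (fun w hw => hn w (hW' hw))
      (fun w' hw' => by
        obtain ⟨p, hp, hp', hpm⟩ := hnB w' (hW' hw')
        exact hedges w' (fun g hg => zero_lt_one.trans_le (hW w' (hW' hw') g hg)) (hW'w w' hw')
          p hp _ hp' (by rw [dotR_smul, dotR_quarterTurn_self, mul_zero]) hpm) rfl
    refine (add_le_add_left h1 _).trans ?_
    have hconv₁ : Convex ℝ (convexHull ℝ (B₁ : Set (ℝ × ℝ)) + C) :=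
      (convex_convexHull ℝ _).add hCconv
    have hcomp₁ : IsCompact (convexHull ℝ (B₁ : Set (ℝ × ℝ))) :=
      B₁.finite_toSet.isCompact_convexHull ℝ
    obtain ⟨u, hu⟩ := hKne
    rw [hsum, add_right_comm _ ((fun r : ℝ => r • m • quarterTurn w) '' Set.Icc 0 1) K]
    have hqmem := subset_convexHull ℝ (B₁ : Set (ℝ × ℝ)) hqB₁
    refine volume_diff_add_le_of_segment (q := q) hconv₁ (hconv₁.add hKconv)
      (measurableSet_add_coneOver hKcomp hcomp₁) ?_ hm (hwK u hu)
      (fun l hl => Set.add_mem_add hqmem ⟨l, hl, u, hu, rfl⟩) ?_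
    · rw [add_right_comm]
      exact measurableSet_add_coneOver hKcomp (hcomp₁.add hKcomp)
    · rintro _ ⟨_, ⟨x, hx, _, ⟨t, ht, g, hg, rfl⟩, rfl⟩, g', hg', rfl⟩
      have h8 : convexHull ℝ (B₁ : Set (ℝ × ℝ)) ⊆ {x | dotR w q ≤ dotR w x} :=
        convexHull_min hmin₁ (convex_dotR_ge w _)
      have h9 : dotR w q ≤ dotR w x := h8 hx
      change dotR w q + δ ≤ dotR w (x + t • g + g')
      rw [dotR_add, dotR_add, dotR_smul]
      have := mul_nonneg ht (hwK g hg).le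
      linarith [hδ g' hg']
  by_cases hcase : ∃ w ∈ W, 0 < n w
  · obtain ⟨w, hw, hnw⟩ := hcase
    obtain ⟨p, hp, hp', hpm⟩ := hnB w hw
    have := step (W.erase w) w p (n w) 1 (Finset.erase_subset _ _)
      (fun w' hw' => hWW w hw w' (Finset.mem_of_mem_erase hw') (Finset.ne_of_mem_erase hw'))
      (fun g hg => zero_lt_one.trans_le (hW w hw g hg)) (hW w hw) hnw hp hp' hpm
    rwa [mul_one, add_assoc, Finset.sum_erase_add _ _ hw] at this
  have hsum0 : ∑ w ∈ W, ENNReal.ofReal (n w) = 0 :=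
    Finset.sum_eq_zero fun w hw => ENNReal.ofReal_of_nonpos (not_lt.1 fun h => hcase ⟨w, hw, h⟩)
  rw [hsum0, add_zero]
  by_cases hedge : ∃ (w q : ℝ × ℝ) (m : ℝ), (∀ g ∈ K, 0 < dotR w g) ∧ 0 < m ∧ q ∈ B ∧
      q + m • quarterTurn w ∈ B ∧ ∀ b ∈ B, dotR w q ≤ dotR w b
  · obtain ⟨w, q, m, hwK, hm, hq, hq', hmin⟩ := hedge
    simpa using step ∅ w q m 0 (Finset.empty_subset _) (by simp) hwK
      (fun g hg => (hwK g hg).le) hm hq hq' hmin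
  · obtain ⟨q, hq, hqC⟩ := exists_sub_mem_coneOver hG hGne h0 hB
      (fun w q m h1 h2 h3 h4 h5 => hedge ⟨w, q, m, h1, h2, h3, h4, h5⟩)
    have hX : convexHull ℝ (B : Set (ℝ × ℝ)) + C = q +ᵥ C := by
      apply Set.Subset.antisymm
      · rintro _ ⟨x, hx, c, hc, rfl⟩
        have h1 : convexHull ℝ (B : Set (ℝ × ℝ)) ⊆ q +ᵥ C := by
          refine convexHull_min (fun b hb => ⟨b - q, hqC b hb, by simp⟩) (hCconv.vadd q)
        obtain ⟨c', hc', rfl⟩ := h1 hx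
        exact ⟨c' + c, add_mem_coneOver hKconv hc' hc, by simp [add_assoc]⟩
      · rintro _ ⟨c, hc, rfl⟩
        exact Set.add_mem_add (subset_convexHull ℝ _ hq) hc
    rw [hX, vadd_add_assoc, ← Set.vadd_set_sdiff]
    exact (measure_vadd _ _ _).ge

lemma mem_convexHull_insert_zero {G : Set (ℝ × ℝ)} (hG : G.Nonempty) {x : ℝ × ℝ} :
    x ∈ convexHull ℝ (insert 0 G) ↔ ∃ t : ℝ, 0 ≤ t ∧ t ≤ 1 ∧ ∃ g ∈ convexHull ℝ G, x = t • g := by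
  rw [convexHull_insert hG, convexJoin_singleton_left]
  simp only [Set.mem_iUnion, exists_prop]
  constructor
  · rintro ⟨g, hg, a, b, ha, hb, hab, rfl⟩
    exact ⟨b, hb, by linarith, g, hg, by simp⟩
  · rintro ⟨t, ht, ht1, g, hg, rfl⟩
    exact ⟨g, hg, 1 - t, t, by linarith, ht, by ring, by simp⟩

lemma convexHull_insert_zero_diff_subset {G : Set (ℝ × ℝ)} (hG : G.Nonempty)
    (h0 : (0 : ℝ × ℝ) ∉ convexHull ℝ G) :
    convexHull ℝ (insert 0 G) \ convexHull ℝ G ⊆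
      coneOver (convexHull ℝ G) \ (coneOver (convexHull ℝ G) + convexHull ℝ G) := by
  have hK := convex_convexHull ℝ G
  rintro x ⟨hxP, hxK⟩
  obtain ⟨t, ht, ht1, g, hg, rfl⟩ := (mem_convexHull_insert_zero hG).1 hxP
  refine ⟨⟨t, ht, g, hg, rfl⟩, ?_⟩
  rintro ⟨_, ⟨s, hs, g₁, hg₁, rfl⟩, g₂, hg₂, h⟩
  obtain ⟨a, ha, hsum⟩ := exists_smul_eq_smul_add_smul hK hs zero_le_one hg₁ hg₂
  have h' : t • g = (s + 1) • a := by rw [← hsum, one_smul]; exact h.symm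
  have hs1 : 0 < s + 1 := by linarith
  have ht0 : 0 < t := by
    refine lt_of_le_of_ne ht fun h => h0 ?_
    rw [← h, zero_smul] at h'
    rwa [(smul_eq_zero.1 h'.symm).resolve_left hs1.ne'] at ha
  have hga : g = ((s + 1) / t) • a := by
    rw [div_eq_inv_mul, mul_smul, ← h', smul_smul, inv_mul_cancel₀ ht0.ne', one_smul]
  refine hxK ?_
  by_cases hst : s + 1 = t
  · rw [hst] at h'
    rw [← hst]
    have : s + 1 = 1 := by linarith
    rw [this, one_smul]; exact hg
  · have hlt : 0 < s + 1 - t := lt_of_le_of_ne (by linarith) fun h => hst (by linarith)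
    have hcomb : t • g = (t * s / (s + 1 - t)) • g + (1 - t * s / (s + 1 - t)) • a := by
      rw [hga, smul_smul, smul_smul, ← add_smul]
      congr 1
      field_simp
      ring
    rw [hcomb]
    have h1 : t * s / (s + 1 - t) ≤ 1 := by
      rw [div_le_one hlt]; nlinarith
    exact hK hg ha (by positivity) (by linarith) (by ring)

lemma add_coneOver_diff_subset {G Q : Set (ℝ × ℝ)} (hG : G.Nonempty) :
    (Q + coneOver (convexHull ℝ G)) \ (Q + coneOver (convexHull ℝ G) + convexHull ℝ G) ⊆
      (convexHull ℝ (insert 0 G) + Q) \ (convexHull ℝ G + Q) := by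
  rintro _ ⟨⟨q, hq, _, ⟨t, ht, g, hg, rfl⟩, rfl⟩, hx⟩
  have ht1 : t ≤ 1 := by
    by_contra! h
    refine hx ⟨q + (t - 1) • g, Set.add_mem_add hq ⟨t - 1, by linarith, g, hg, rfl⟩, g, hg, ?_⟩
    simp only [sub_smul, one_smul]
    abel
  refine ⟨⟨t • g, (mem_convexHull_insert_zero hG).2 ⟨t, ht, ht1, g, hg, rfl⟩, q, hq,
    add_comm _ _⟩, ?_⟩
  rintro ⟨k, hk, q', hq', h⟩
  refine hx ⟨q' + 0, Set.add_mem_add hq' (zero_mem_coneOver ⟨g, hg⟩), k, hk, ?_⟩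
  rw [← h]
  simp [add_comm]

/-- Inserting the origin into `G` increases the mixed area of `G` and `B` at least by the sum of
the lengths `n w` of the edges of `B` whose inner normal `w` is positive on `G`. -/
lemma volume_insert_zero_add_le {G : Set (ℝ × ℝ)} (hG : G.Finite) (hGne : G.Nonempty)
    (h0 : (0 : ℝ × ℝ) ∉ convexHull ℝ G) (B : Finset (ℝ × ℝ)) (hB : B.Nonempty)
    (W : Finset (ℝ × ℝ)) (n : ℝ × ℝ → ℝ)
    (hW : ∀ w ∈ W, ∀ g ∈ convexHull ℝ G, 1 ≤ dotR w g)
    (hWW : ∀ w ∈ W, ∀ w' ∈ W, w' ≠ w → dotR w' (quarterTurn w) ≠ 0)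
    (hn : ∀ w ∈ W, 0 ≤ n w)
    (hnB : ∀ w ∈ W, ∃ p ∈ B, p + n w • quarterTurn w ∈ B ∧ ∀ b ∈ B, dotR w p ≤ dotR w b) :
    volume (convexHull ℝ (insert 0 G)) +
        volume (convexHull ℝ G + convexHull ℝ (B : Set (ℝ × ℝ))) +
        ∑ w ∈ W, ENNReal.ofReal (n w) ≤
      volume (convexHull ℝ (insert 0 G) + convexHull ℝ (B : Set (ℝ × ℝ))) +
        volume (convexHull ℝ G) := by
  have hmain := volume_cone_diff_add_sum_le hG hGne h0 B hB W n hW hWW hn hnB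
  set K := convexHull ℝ G
  set P := convexHull ℝ (insert 0 G)
  set Q := convexHull ℝ (B : Set (ℝ × ℝ))
  have hKP : K ⊆ P := convexHull_mono (Set.subset_insert _ _)
  have hKcomp : IsCompact K := hG.isCompact_convexHull ℝ
  have hQcomp : IsCompact Q := B.finite_toSet.isCompact_convexHull ℝ
  have h1 : volume P ≤ volume K + volume (coneOver K \ (coneOver K + K)) := by
    rw [← measure_sdiff_add_inter P hKcomp.measurableSet, Set.inter_eq_right.2 hKP, add_comm]
    exact add_le_add_right (measure_mono (convexHull_insert_zero_diff_subset hGne h0)) _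
  have h2 : volume (K + Q) + volume ((Q + coneOver K) \ (Q + coneOver K + K)) ≤
      volume (P + Q) := by
    rw [← measure_sdiff_add_inter (P + Q) (hKcomp.add hQcomp).measurableSet,
      Set.inter_eq_right.2 (Set.add_subset_add_right hKP), add_comm]
    exact add_le_add_left (measure_mono (add_coneOver_diff_subset hGne)) _
  calc _ ≤ volume K + volume (coneOver K \ (coneOver K + K)) + volume (K + Q) +
        ∑ w ∈ W, ENNReal.ofReal (n w) := by gcongr
    _ = volume K + (volume (K + Q) + (volume (coneOver K \ (coneOver K + K)) +
        ∑ w ∈ W, ENNReal.ofReal (n w))) := by ring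
    _ ≤ volume K + (volume (K + Q) + volume ((Q + coneOver K) \ (Q + coneOver K + K))) := by
        gcongr
    _ ≤ volume K + volume (P + Q) := by gcongr
    _ = _ := add_comm _ _

/-- Version of `volume_insert_zero_add_le` for an arbitrary inserted point `v`. -/
lemma volume_insert_add_le {S : Set (ℝ × ℝ)} (hS : S.Finite) (hSne : S.Nonempty) {v : ℝ × ℝ}
    (hv : v ∉ convexHull ℝ S) (B : Finset (ℝ × ℝ)) (hB : B.Nonempty)
    (W : Finset (ℝ × ℝ)) (n : ℝ × ℝ → ℝ)
    (hW : ∀ w ∈ W, ∀ s ∈ S, dotR w v + 1 ≤ dotR w s)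
    (hWW : ∀ w ∈ W, ∀ w' ∈ W, w' ≠ w → dotR w' (quarterTurn w) ≠ 0)
    (hn : ∀ w ∈ W, 0 ≤ n w)
    (hnB : ∀ w ∈ W, ∃ p ∈ B, p + n w • quarterTurn w ∈ B ∧ ∀ b ∈ B, dotR w p ≤ dotR w b) :
    volume (convexHull ℝ (insert v S)) +
        volume (convexHull ℝ S + convexHull ℝ (B : Set (ℝ × ℝ))) +
        ∑ w ∈ W, ENNReal.ofReal (n w) ≤
      volume (convexHull ℝ (insert v S) + convexHull ℝ (B : Set (ℝ × ℝ))) +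
        volume (convexHull ℝ S) := by
  set G : Set (ℝ × ℝ) := -v +ᵥ S
  have hSG : S = v +ᵥ G := (vadd_neg_vadd v S).symm
  have hins : insert v S = v +ᵥ insert 0 G := by
    rw [Set.vadd_set_insert, ← hSG, vadd_eq_add, add_zero]
  rw [hins, hSG, convexHull_vadd, convexHull_vadd, vadd_add_assoc, vadd_add_assoc]
  simp only [measure_vadd]
  refine volume_insert_zero_add_le hS.vadd_set hSne.vadd_set (fun h => hv ?_) B hB W n
    (fun w hw => convexHull_min ?_ (convex_dotR_ge w 1)) hWW hn hnB
  · rw [hSG, convexHull_vadd]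
    exact ⟨0, h, by simp⟩
  · rintro _ ⟨s, hs, rfl⟩
    have := hW w hw s hs
    change 1 ≤ dotR w (-v + s)
    rw [neg_add_eq_sub, dotR_sub]
    linarith

lemma toR2_injective : Function.Injective toR2 := by
  rintro ⟨a, b⟩ ⟨c, d⟩ h
  simpa [toR2] using h

lemma toR2_add (p q : Pt) : toR2 (p + q) = toR2 p + toR2 q := by
  simp [toR2]

lemma dotR_toR2 (w p : Pt) : dotR (toR2 w) (toR2 p) = dotZ w p := by
  simp [dotR, dotZ, toR2]

lemma convexHull_toR2_add (A B : Finset Pt) :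
    convexHull ℝ (toR2 '' ((A + B : Finset Pt) : Set Pt)) =
      convexHull ℝ (toR2 '' (A : Set Pt)) + convexHull ℝ (toR2 '' (B : Set Pt)) := by
  rw [← convexHull_add, Finset.coe_add]
  exact congrArg _ (Set.image_add (AddMonoidHom.mk' toR2 toR2_add))

lemma FullDim.erase_nonempty {A : Finset Pt} (hA : FullDim A) (v : Pt) :
    (A.erase v).Nonempty := by
  rw [Finset.nonempty_iff_ne_empty]
  intro h
  refine hA ((collinear_singleton ℝ (toR2 v)).subset ?_)
  rintro _ ⟨a, ha, rfl⟩
  by_contra hne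
  have : a ∈ A.erase v := Finset.mem_erase.2 ⟨fun h => hne (by rw [h]; rfl), ha⟩
  simp [h] at this

lemma FullDim.nonempty {A : Finset Pt} (hA : FullDim A) : A.Nonempty :=
  (hA.erase_nonempty 0).mono (Finset.erase_subset _ _)

lemma mmult_eq (A B : Finset Pt) (v : Pt) :
    mmult A B v =
      volume.real (convexHull ℝ (toR2 '' (A : Set Pt)) + convexHull ℝ (toR2 '' (B : Set Pt))) -
      volume.real (convexHull ℝ (toR2 '' (A : Set Pt))) -
      (volume.real (convexHull ℝ (toR2 '' ((A.erase v : Finset Pt) : Set Pt)) +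
        convexHull ℝ (toR2 '' (B : Set Pt))) -
      volume.real (convexHull ℝ (toR2 '' ((A.erase v : Finset Pt) : Set Pt)))) := by
  simp only [mmult, mvol, narea, convexHull_toR2_add, Measure.real]
  ring

/-- The mixed multiplicity of a vertex `v` of `A` is at least the sum of the lengths `n w` of edges
of `B` whose inner normals `w` attain their minimum on `A` only at `v`. -/
lemma sum_le_mmult {A B : Finset Pt} {v : Pt} (hv : IsVertex A v) (hA : (A.erase v).Nonempty)
    (hB : B.Nonempty) (W : Finset Pt) (n : Pt → ℕ)
    (hW : ∀ w ∈ W, ∀ a ∈ A.erase v, dotZ w v + 1 ≤ dotZ w a)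
    (hWW : ∀ w ∈ W, ∀ w' ∈ W, w' ≠ w → dotZ w' (-w.2, w.1) ≠ 0)
    (hnB : ∀ w ∈ W, ∃ p ∈ B, p + (n w : ℤ) • ((-w.2, w.1) : Pt) ∈ B ∧
      ∀ b ∈ B, dotZ w p ≤ dotZ w b) :
    ∑ w ∈ W, (n w : ℝ) ≤ mmult A B v := by
  classical
  have hturn : ∀ w : Pt, quarterTurn (toR2 w) = toR2 (-w.2, w.1) := fun w => by
    simp [quarterTurn, toR2]
  have key := volume_insert_add_le (S := toR2 '' ((A.erase v : Finset Pt) : Set Pt))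
    ((A.erase v).finite_toSet.image _) (hA.to_set.image _) hv.2 (B.image toR2) (hB.image _)
    (W.image toR2) (fun x => (n (Function.invFun toR2 x) : ℝ))
    (by
      simp only [Finset.forall_mem_image]
      rintro w hw _ ⟨a, ha, rfl⟩
      rw [dotR_toR2, dotR_toR2]
      exact_mod_cast hW w hw a ha)
    (by
      simp only [Finset.forall_mem_image]
      intro w hw w' hw' hne
      rw [hturn, dotR_toR2]
      exact_mod_cast hWW w hw w' hw' fun h => hne (by rw [h]))
    (fun _ _ => Nat.cast_nonneg _)
    (by
      simp only [Finset.forall_mem_image]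
      intro w hw
      obtain ⟨p, hp, hp', hmin⟩ := hnB w hw
      refine ⟨toR2 p, Finset.mem_image_of_mem _ hp, ?_, fun b hb => ?_⟩
      · rw [Function.leftInverse_invFun toR2_injective w]
        refine Finset.mem_image.2 ⟨_, hp', ?_⟩
        simp [toR2, quarterTurn]
      · rw [dotR_toR2, dotR_toR2]
        exact_mod_cast hmin b hb)
  have hins : insert (toR2 v) (toR2 '' ((A.erase v : Finset Pt) : Set Pt)) =
      toR2 '' (A : Set Pt) := by
    rw [← Set.image_insert_eq, ← Finset.coe_insert, Finset.insert_erase hv.1]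
  rw [hins, Finset.sum_image toR2_injective.injOn, Finset.coe_image] at key
  simp only [Function.leftInverse_invFun toR2_injective _, ENNReal.ofReal_natCast] at key
  have hcomp : ∀ s : Finset Pt, IsCompact (convexHull ℝ (toR2 '' (s : Set Pt))) := fun s =>
    (s.finite_toSet.image _).isCompact_convexHull ℝ
  have hfin : ∀ s : Finset Pt, volume (convexHull ℝ (toR2 '' (s : Set Pt))) ≠ ⊤ := fun s =>
    (hcomp s).measure_lt_top.ne
  have hfin' : ∀ s t : Finset Pt, volume (convexHull ℝ (toR2 '' (s : Set Pt)) +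
      convexHull ℝ (toR2 '' (t : Set Pt))) ≠ ⊤ := fun s t =>
    ((hcomp s).add (hcomp t)).measure_lt_top.ne
  have key' := ENNReal.toReal_mono (ENNReal.add_ne_top.2 ⟨hfin' _ _, hfin _⟩) key
  rw [ENNReal.toReal_add (ENNReal.add_ne_top.2 ⟨hfin _, hfin' _ _⟩) (by simp),
    ENNReal.toReal_add (hfin _) (hfin' _ _), ENNReal.toReal_add (hfin' _ _) (hfin _),
    ENNReal.toReal_sum (by simp)] at key'
  simp only [ENNReal.toReal_natCast] at key'
  rw [mmult_eq]
  simp only [Measure.real]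
  linarith

/-- An edge contains two points that differ by a multiple of the primitive direction which is at
least the normalized length. -/
lemma IsEdgeWith.exists_add_smul_mem {A e : Finset Pt} {w : Pt} {c : ℤ} (h : IsEdgeWith A w c e) :
    ∃ n : ℕ, llen e ≤ n ∧ ∃ p ∈ A, p + (n : ℤ) • ((-w.2, w.1) : Pt) ∈ A ∧
      ∀ b ∈ A, dotZ w p ≤ dotZ w b := by
  obtain ⟨hgcd, hmin, he, hcard⟩ := h
  have hne : e.Nonempty := Finset.card_pos.1 (by omega)
  have hbez : w.1 * Int.gcdA w.1 w.2 + w.2 * Int.gcdB w.1 w.2 = 1 := by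
    rw [← Int.gcd_eq_gcd_ab, hgcd]; rfl
  set k : Pt := (-Int.gcdB w.1 w.2, Int.gcdA w.1 w.2) with hk
  have hkw : k.2 * w.1 - k.1 * w.2 = 1 := by simp only [hk]; linarith
  obtain ⟨p, hp, hpmin⟩ := e.exists_min_image (dotZ k) hne
  obtain ⟨p', hp', hpmax⟩ := e.exists_max_image (dotZ k) hne
  have hdot : ∀ a ∈ e, a ∈ A ∧ dotZ w a = c := fun a ha => by
    rw [he] at ha
    exact Finset.mem_filter.1 ha
  have hN : 0 ≤ dotZ k p' - dotZ k p := by linarith [hpmin p' hp']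
  obtain ⟨n, hn⟩ := Int.eq_ofNat_of_zero_le hN
  have hinj : ∀ x y : Pt, dotZ w x = dotZ w y → dotZ k x = dotZ k y → x = y := by
    intro x y h1 h2
    simp only [dotZ] at h1 h2
    ext
    · linear_combination (-(x.1 - y.1)) * hkw + k.2 * h1 - w.2 * h2
    · linear_combination (-(x.2 - y.2)) * hkw - k.1 * h1 + w.1 * h2
  refine ⟨n, ?_, p, (hdot p hp).1, ?_, fun b hb => by rw [(hdot p hp).2]; exact hmin b hb⟩
  · have hsub : ∀ z ∈ {z : Pt | toR2 z ∈ convexHull ℝ (toR2 '' (e : Set Pt))},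
        dotZ w z = c ∧ dotZ k z ∈ Set.Icc (dotZ k p) (dotZ k p') := by
      intro z hz
      have bound : ∀ (u : Pt) (d : ℤ), (∀ a ∈ e, d ≤ dotZ u a) → d ≤ dotZ u z := by
        intro u d hd
        have : convexHull ℝ (toR2 '' (e : Set Pt)) ⊆ {x | (d : ℝ) ≤ dotR (toR2 u) x} := by
          refine convexHull_min ?_ (convex_dotR_ge _ _)
          rintro _ ⟨a, ha, rfl⟩
          change (d : ℝ) ≤ dotR (toR2 u) (toR2 a)
          rw [dotR_toR2]
          exact_mod_cast hd a ha
        have h2 : (d : ℝ) ≤ dotR (toR2 u) (toR2 z) := this hz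
        rw [dotR_toR2] at h2
        exact_mod_cast h2
      have hneg : ∀ u a : Pt, dotZ (-u) a = -dotZ u a := fun u a => by
        simp only [dotZ, Prod.fst_neg, Prod.snd_neg]; ring
      have h1 := bound w c fun a ha => (hdot a ha).2.ge
      have h2 := bound (-w) (-c) fun a ha => by rw [hneg, (hdot a ha).2]
      have h3 := bound k _ hpmin
      have h4 := bound (-k) (-dotZ k p') fun a ha => by rw [hneg]; linarith [hpmax a ha]
      rw [hneg] at h2 h4
      exact ⟨by linarith, h3, by linarith⟩
    have := Set.ncard_le_ncard_of_injOn (dotZ k) (fun z hz => (hsub z hz).2)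
      (fun x hx y hy hxy => hinj x y ((hsub x hx).1.trans (hsub y hy).1.symm) hxy)
      (Set.finite_Icc _ _)
    rw [← Finset.coe_Icc, Set.ncard_coe_finset, Int.card_Icc] at this
    simp only [llen]
    omega
  · have : p + (n : ℤ) • ((-w.2, w.1) : Pt) = p' := by
      apply hinj
      · rw [(hdot p' hp').2, ← (hdot p hp).2]
        simp [dotZ]; ring
      · have hn' : dotZ k p' = dotZ k p + n := by linarith [hn]
        rw [hn']
        simp only [dotZ, Prod.fst_add, Prod.snd_add, Prod.smul_fst, Prod.smul_snd, smul_eq_mul]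
        linear_combination (n : ℤ) * hkw
    rw [this]
    exact (hdot p' hp').1

/-- If `w` is not the inner normal of an edge of `A`, then its minimum on `A` is attained at a single
vertex. -/
lemma exists_isVertex_of_forall_not_isEdgeWith {A : Finset Pt} (hA : A.Nonempty) {w : Pt}
    (hw : Int.gcd w.1 w.2 = 1) (hedge : ∀ c f, ¬ IsEdgeWith A w c f) :
    ∃ v, IsVertex A v ∧ ∀ a ∈ A.erase v, dotZ w v + 1 ≤ dotZ w a := by
  obtain ⟨v, hv, hmin⟩ := A.exists_min_image (dotZ w) hA
  have hcard : (A.filter fun a => dotZ w a = dotZ w v).card ≤ 1 := by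
    by_contra! h
    exact hedge _ _ ⟨hw, hmin, rfl, h⟩
  have hlt : ∀ a ∈ A.erase v, dotZ w v + 1 ≤ dotZ w a := by
    intro a ha
    obtain ⟨hne, ha⟩ := Finset.mem_erase.1 ha
    refine lt_of_le_of_ne (hmin a ha) fun h => hne ?_
    exact Finset.card_le_one.1 hcard a (Finset.mem_filter.2 ⟨ha, h.symm⟩) v
      (Finset.mem_filter.2 ⟨hv, rfl⟩)
  refine ⟨v, ⟨hv, fun hmem => ?_⟩, hlt⟩
  have hsub : convexHull ℝ (toR2 '' ((A.erase v : Finset Pt) : Set Pt)) ⊆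
      {x | (dotZ w v : ℝ) + 1 ≤ dotR (toR2 w) x} := by
    refine convexHull_min ?_ (convex_dotR_ge _ _)
    rintro _ ⟨a, ha, rfl⟩
    change (dotZ w v : ℝ) + 1 ≤ dotR (toR2 w) (toR2 a)
    rw [dotR_toR2]
    exact_mod_cast hlt a ha
  have h : (dotZ w v : ℝ) + 1 ≤ dotR (toR2 w) (toR2 v) := hsub hmem
  rw [dotR_toR2] at h
  linarith

lemma IsEdgeWith.eq_of_same_normal {A e e' : Finset Pt} {w : Pt} {c c' : ℤ}
    (h : IsEdgeWith A w c e) (h' : IsEdgeWith A w c' e') : e = e' := by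
  obtain ⟨-, hmin, he, hcard⟩ := h
  obtain ⟨-, hmin', he', hcard'⟩ := h'
  obtain ⟨a, ha⟩ : e.Nonempty := Finset.card_pos.1 (by omega)
  obtain ⟨a', ha'⟩ : e'.Nonempty := Finset.card_pos.1 (by omega)
  rw [he, Finset.mem_filter] at ha
  rw [he', Finset.mem_filter] at ha'
  have hc : c = c' := by linarith [hmin a' ha'.1, hmin' a ha.1]
  rw [he, he', hc]

/-- Two primitive vectors in a common open half-plane are equal as soon as they are parallel. -/
lemma eq_of_dotZ_quarterTurn_eq_zero {w w' u : Pt} (hw : Int.gcd w.1 w.2 = 1)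
    (hw' : Int.gcd w'.1 w'.2 = 1) (h : dotZ w' (-w.2, w.1) = 0) (hu : 0 < dotZ w u)
    (hu' : 0 < dotZ w' u) : w' = w := by
  have hb : w.1 * Int.gcdA w.1 w.2 + w.2 * Int.gcdB w.1 w.2 = 1 := by
    rw [← Int.gcd_eq_gcd_ab, hw]; rfl
  have hb' : w'.1 * Int.gcdA w'.1 w'.2 + w'.2 * Int.gcdB w'.1 w'.2 = 1 := by
    rw [← Int.gcd_eq_gcd_ab, hw']; rfl
  simp only [dotZ] at h hu hu'
  generalize Int.gcdA w.1 w.2 = a at hb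
  generalize Int.gcdB w.1 w.2 = b at hb
  generalize Int.gcdA w'.1 w'.2 = a' at hb'
  generalize Int.gcdB w'.1 w'.2 = b' at hb'
  obtain ⟨r, hr⟩ : ∃ r, r = a * w'.1 + b * w'.2 := ⟨_, rfl⟩
  have h1 : w'.1 = r * w.1 := by
    rw [hr]; linear_combination (-w'.1) * hb - b * h
  have h2 : w'.2 = r * w.2 := by
    rw [hr]; linear_combination (-w'.2) * hb + a * h
  have hunit : IsUnit r := IsUnit.of_mul_eq_one (w.1 * a' + w.2 * b') (by
    rw [h1, h2] at hb'; linarith)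
  rcases Int.isUnit_iff.1 hunit with rfl | rfl
  · ext <;> simp [h1, h2]
  · rw [h1, h2] at hu'
    linarith

lemma finsum_llen_le_finsum_mmult (A₁ A₂ : Finset Pt) (h₁ : FullDim A₁) (h₂ : FullDim A₂) :
    (∑ᶠ e ∈ {e : Finset Pt | IsEdge A₂ e ∧ ∀ f, ¬ StronglyParallel A₂ A₁ e f},
        (llen e : ℝ)) ≤ ∑ᶠ v ∈ {v : Pt | IsVertex A₁ v}, mmult A₁ A₂ v := by
  classical
  have hV : {v : Pt | IsVertex A₁ v}.Finite := A₁.finite_toSet.subset fun v hv => hv.1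
  have hS : {e : Finset Pt | IsEdge A₂ e ∧ ∀ f, ¬ StronglyParallel A₂ A₁ e f}.Finite := by
    refine A₂.powerset.finite_toSet.subset ?_
    rintro e ⟨⟨w, c, -, -, rfl, -⟩, -⟩
    exact Finset.mem_powerset.2 (Finset.filter_subset _ _)
  rw [finsum_mem_eq_finite_toFinset_sum _ hV, finsum_mem_eq_finite_toFinset_sum _ hS]
  have hdata : ∀ e ∈ hS.toFinset, ∃ (w v : Pt) (n : ℕ), (∃ c, IsEdgeWith A₂ w c e) ∧
      IsVertex A₁ v ∧ (∀ a ∈ A₁.erase v, dotZ w v + 1 ≤ dotZ w a) ∧ llen e ≤ n ∧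
      ∃ p ∈ A₂, p + (n : ℤ) • ((-w.2, w.1) : Pt) ∈ A₂ ∧ ∀ b ∈ A₂, dotZ w p ≤ dotZ w b := by
    intro e he
    obtain ⟨⟨w, c, hwc⟩, hpar⟩ := hS.mem_toFinset.1 he
    obtain ⟨v, hv, hlt⟩ := exists_isVertex_of_forall_not_isEdgeWith h₁.nonempty hwc.1
      fun c' f hf => hpar f ⟨w, c, c', hwc, hf⟩
    obtain ⟨n, hn, hp⟩ := hwc.exists_add_smul_mem
    exact ⟨w, v, n, ⟨c, hwc⟩, hv, hlt, hn, hp⟩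
  choose! w v n hw hv hlt hn hp using hdata
  rw [← Finset.sum_fiberwise_of_maps_to (fun e he => hV.mem_toFinset.2 (hv e he))]
  refine Finset.sum_le_sum fun x hx => ?_
  have hx : IsVertex A₁ x := hV.mem_toFinset.1 hx
  set F := hS.toFinset.filter fun e => v e = x
  have hF : ∀ e ∈ F, e ∈ hS.toFinset ∧ v e = x := fun e he => Finset.mem_filter.1 he
  have hinj : Set.InjOn w F := by
    intro e he e' he' hee
    obtain ⟨c, hc⟩ := hw e (hF e he).1
    obtain ⟨c', hc'⟩ := hw e' (hF e' he').1
    rw [← hee] at hc'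
    exact hc.eq_of_same_normal hc'
  have hinv := hinj.leftInvOn_invFunOn
  have key := sum_le_mmult hx (h₁.erase_nonempty x) h₂.nonempty (F.image w)
    (fun y => n (Function.invFunOn w F y)) ?_ ?_ ?_
  · rw [Finset.sum_image hinj] at key
    refine le_trans (Finset.sum_le_sum fun e he => ?_) key
    rw [hinv he]
    exact_mod_cast hn e (hF e he).1
  · simp only [Finset.forall_mem_image]
    intro e he
    have := hlt e (hF e he).1
    rwa [(hF e he).2] at this
  · simp only [Finset.forall_mem_image]
    intro e he e' he' hne h0
    obtain ⟨a, ha⟩ := h₁.erase_nonempty x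
    obtain ⟨c, hc⟩ := hw e (hF e he).1
    obtain ⟨c', hc'⟩ := hw e' (hF e' he').1
    have hpos : ∀ e ∈ F, 0 < dotZ (w e) (a - x) := by
      intro e he
      have := hlt e (hF e he).1 a (by rwa [(hF e he).2])
      rw [(hF e he).2] at this
      simp only [dotZ, Prod.fst_sub, Prod.snd_sub] at this ⊢
      linarith
    exact hne (eq_of_dotZ_quarterTurn_eq_zero hc.1 hc'.1 h0 (hpos e he) (hpos e' he'))
  · simp only [Finset.forall_mem_image]
    intro e he
    rw [hinv he]
    exact hp e (hF e he).1

/-- **Proposition 3.9 (1).**  For full-dimensional planar configurations, the sum of the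
mixed multiplicities over the vertices of one configuration is bounded below by the
total normalized length of the edges of the other configuration that are not strongly
parallel to any edge of the first. -/
theorem sum_mixed_multiplicities_ge_length_nonparallel_edges
    (A₁ A₂ : Finset Pt) (h₁ : FullDim A₁) (h₂ : FullDim A₂) :
    ((∑ᶠ e ∈ {e : Finset Pt | IsEdge A₂ e ∧ ∀ f, ¬ StronglyParallel A₂ A₁ e f},
        (llen e : ℝ)) ≤ ∑ᶠ v ∈ {v : Pt | IsVertex A₁ v}, mmult A₁ A₂ v)
    ∧ ((∑ᶠ e ∈ {e : Finset Pt | IsEdge A₁ e ∧ ∀ f, ¬ StronglyParallel A₁ A₂ e f},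
        (llen e : ℝ)) ≤ ∑ᶠ v ∈ {v : Pt | IsVertex A₂ v}, mmult A₂ A₁ v) :=
  ⟨finsum_llen_le_finsum_mmult A₁ A₂ h₁ h₂, finsum_llen_le_finsum_mmult A₂ A₁ h₂ h₁⟩
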